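/- arXiv:1503.05620 — 2 statements merged into one kernel-verified Lean document; each statement's English description precedes it below -/
import Mathlib

section
/- Let R be a commutative ring, k ≥ 1, and let Δ be a finite abstract simplicial complex. Assume (1) Δ is decomposition ℓ-chordal over R for every ℓ with k ≤ ℓ ≤ 2k−1, and (2) Δ has no missing faces of dimension > k. Then Δ is decomposition ℓ-chordal over R for every ℓ ≥ k, and moreover Δ is k-Leray over R (i.e., H̃_j(Δ|V; R) = 0 for every j ≥ k and every vertex subset V). -/
/-!
Basic notions for homological chordality of simplicial complexes,
following Adiprasito–Nevo–Samper, "Higher chordality: From graphs to complexes".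

A finite abstract simplicial complex is modelled as a downward-closed finite
family of finite subsets of a vertex type `V`.  Chains of dimension `k` (with
coefficients in a commutative ring `R`) are functions `Finset V → R` supported
on faces of cardinality `k + 1`; the simplicial boundary operator includes the
augmentation (so `0`-cycles are *reduced* cycles), matching the paper's
convention that `C₋₁` is generated by the empty face.
-/

open Finset

attribute [local instance] Classical.propDecidable

noncomputable section

/-- A finite abstract simplicial complex with vertices in `V`:
a downward-closed finite family of finite subsets of `V`. -/
structure ASC (V : Type*) where
  faces : Finset (Finset V)
  down_closed : ∀ ⦃s t : Finset V⦄, s ∈ faces → t ⊆ s → t ∈ faces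

variable {V : Type*} [Fintype V] [LinearOrder V]

/-- `(-1)` to the number of elements of `t` smaller than `v`; this is the sign
of the position of `v` in the ordered set `insert v t`. -/
def esign (v : V) (t : Finset V) : ℤ :=
  (-1) ^ (t.filter fun w => w < v).card

/-- The simplicial boundary operator (including the augmentation at the empty
face): `(bdry c) t = ∑_{v ∉ t} ± c (insert v t)`. -/
def bdry {R : Type*} [CommRing R] (c : Finset V → R) : Finset V → R :=
  fun t => ∑ v ∈ tᶜ, esign v t • c (insert v t)

/-- `c` is a chain of dimension `k` on the set of faces `S`:
it is supported on members of `S` of cardinality `k + 1`. -/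
def IsChainOn {R : Type*} [CommRing R] (S : Set (Finset V)) (k : ℤ)
    (c : Finset V → R) : Prop :=
  ∀ s : Finset V, c s ≠ 0 → s ∈ S ∧ (s.card : ℤ) = k + 1

/-- The vertex support `c⁰` of a chain: all vertices lying in a face with a
nonzero coefficient. -/
def vsupp {R : Type*} [CommRing R] (c : Finset V → R) : Set V :=
  {v | ∃ s : Finset V, c s ≠ 0 ∧ v ∈ s}

/-- Vanishing of the `k`-th (reduced) homology of the family of faces `S` over `R`:
every `k`-cycle is the boundary of a `(k+1)`-chain. -/
def HVanish (R : Type*) [CommRing R] (S : Set (Finset V)) (k : ℤ) : Prop :=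
  ∀ z : Finset V → R, IsChainOn S k z → bdry z = 0 →
    ∃ c : Finset V → R, IsChainOn S (k + 1) c ∧ bdry c = z

/-- `Δ` is resolution `k`-chordal over `R`: every `k`-cycle `z` of `Δ` admits a
resolution, i.e. a `(k+1)`-chain `c` of `Δ` with `∂c = z` and the same vertex
support as `z`. -/
def ResChordal (R : Type*) [CommRing R] (Δ : ASC V) (k : ℤ) : Prop :=
  ∀ z : Finset V → R, IsChainOn (↑Δ.faces) k z → bdry z = 0 →
    ∃ c : Finset V → R, IsChainOn (↑Δ.faces) (k + 1) c ∧ bdry c = z ∧ vsupp c = vsupp z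

/-- `z` is a complete `k`-cycle on the face set `S`: it is a `k`-cycle whose
faces with nonzero coefficient are precisely all the `k`-dimensional faces of
some set `W` of `k + 2` vertices, and all those faces belong to `S`. -/
def IsCompleteCycleOn {R : Type*} [CommRing R] (S : Set (Finset V)) (k : ℤ)
    (z : Finset V → R) : Prop :=
  bdry z = 0 ∧ ∃ W : Finset V, (W.card : ℤ) = k + 2 ∧
    (∀ s : Finset V, z s ≠ 0 ↔ s ⊆ W ∧ (s.card : ℤ) = k + 1) ∧
    ∀ s : Finset V, s ⊆ W → (s.card : ℤ) = k + 1 → s ∈ S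

/-- `Δ` is decomposition `k`-chordal over `R`: every `k`-cycle `z` of `Δ` is a
sum of complete `k`-cycles of `Δ` supporting only vertices supported in `z`. -/
def DecChordal (R : Type*) [CommRing R] (Δ : ASC V) (k : ℤ) : Prop :=
  ∀ z : Finset V → R, IsChainOn (↑Δ.faces) k z → bdry z = 0 →
    ∃ (n : ℕ) (zs : Fin n → Finset V → R),
      z = ∑ i, zs i ∧
      ∀ i, IsCompleteCycleOn (↑Δ.faces) k (zs i) ∧ vsupp (zs i) ⊆ vsupp z

/-- `σ` is a missing face (minimal nonface) of `Δ`: `σ` is not a face but all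
its proper subsets are.  Its dimension is `σ.card - 1`. -/
def IsMissingFace (Δ : ASC V) (σ : Finset V) : Prop :=
  σ ∉ Δ.faces ∧ ∀ t ⊂ σ, t ∈ Δ.faces

/-- The induced subcomplex `Δ|W` on a subset `W` of the vertices. -/
def induced (Δ : ASC V) (W : Finset V) : ASC V where
  faces := Δ.faces.filter fun s => s ⊆ W
  down_closed := by
    intro s t hs hts
    simp only [mem_filter] at hs ⊢
    exact ⟨Δ.down_closed hs.1 hts, hts.trans hs.2⟩

/-- `Δ` is `k`-Leray over `R`: the reduced homology `H̃ⱼ(Δ|W; R)` vanishes for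
every `j ≥ k` and every vertex subset `W`. -/
def IsLeray (R : Type*) [CommRing R] (Δ : ASC V) (k : ℤ) : Prop :=
  ∀ (W : Finset V) (j : ℤ), k ≤ j → HVanish R (((induced Δ W).faces : Set (Finset V))) j

/-- The closed star `St_σ Δ = ∪_{σ ⊆ τ ∈ Δ} 2^τ`. -/
def star (Δ : ASC V) (σ : Finset V) : ASC V where
  faces := Δ.faces.filter fun s => ∃ τ ∈ Δ.faces, σ ⊆ τ ∧ s ⊆ τ
  down_closed := by
    intro s t hs hts
    simp only [mem_filter] at hs ⊢
    obtain ⟨h1, τ', h2, h3, h4⟩ := hs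
    exact ⟨Δ.down_closed h1 hts, τ', h2, h3, hts.trans h4⟩

/-- The deletion `Δ - σ`: the maximal subcomplex of `Δ` not containing `σ`. -/
def del (Δ : ASC V) (σ : Finset V) : ASC V where
  faces := Δ.faces.filter fun s => ¬ σ ⊆ s
  down_closed := by
    intro s t hs hts
    simp only [mem_filter] at hs ⊢
    exact ⟨Δ.down_closed hs.1 hts, fun h => hs.2 (h.trans hts)⟩

/-- The extended link `eLk_σ Δ = St_σ Δ - σ`. -/
def eLk (Δ : ASC V) (σ : Finset V) : ASC V := del (star Δ σ) σ

/-- The link `Lk_σ Δ = {τ \ σ : σ ⊆ τ ∈ Δ}`. -/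
def link (Δ : ASC V) (σ : Finset V) : ASC V where
  faces := Finset.univ.filter fun t => Disjoint σ t ∧ σ ∪ t ∈ Δ.faces
  down_closed := by
    intro s t hs hts
    simp only [mem_filter, mem_univ, true_and] at hs ⊢
    exact ⟨hs.1.mono_right hts, Δ.down_closed hs.2 (union_subset_union_right hts)⟩

/-- The `k`-clique complex `Cl_k Δ`: faces are the sets of vertices of `Δ` all
of whose subsets of cardinality at most `k + 1` are faces of `Δ`. -/
def clique (Δ : ASC V) (k : ℤ) : ASC V where
  faces := Finset.univ.filter fun s =>
    (∀ v ∈ s, {v} ∈ Δ.faces) ∧ ∀ t ⊆ s, (t.card : ℤ) ≤ k + 1 → t ∈ Δ.faces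
  down_closed := by
    intro s t hs hts
    simp only [mem_filter, mem_univ, true_and] at hs ⊢
    exact ⟨fun v hv => hs.1 v (hts hv), fun u hu hc => hs.2 u (hu.trans hts) hc⟩

/-- The vertex set of a complex, as a set of elements of `V`. -/
def vertexSet (Δ : ASC V) : Set V := {v | {v} ∈ Δ.faces}

/-- The relative simplicial complex `(Δ, Γ)` is resolution `k`-chordal over `R`:
every relative `k`-cycle (a `k`-chain of `Δ` supported off `Γ` whose boundary
is a chain of `Γ`) admits a resolution, i.e. a `(k+1)`-chain `c` of `Δ`
supported off `Γ` with `∂c ≡ z` modulo chains of `Γ` and `vsupp c = vsupp z`. -/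
def RelResChordal (R : Type*) [CommRing R] (Δ Γ : ASC V) (k : ℤ) : Prop :=
  ∀ z : Finset V → R, IsChainOn (↑Δ.faces) k z → (∀ s, z s ≠ 0 → s ∉ Γ.faces) →
    IsChainOn (↑Γ.faces) (k - 1) (bdry z) →
    ∃ c : Finset V → R, IsChainOn (↑Δ.faces) (k + 1) c ∧ (∀ s, c s ≠ 0 → s ∉ Γ.faces) ∧
      IsChainOn (↑Γ.faces) k (bdry c - z) ∧ vsupp c = vsupp z

/-- The union of two simplicial complexes (taken facewise). -/
def aunion (Δ Γ : ASC V) : ASC V where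
  faces := Δ.faces ∪ Γ.faces
  down_closed := by
    intro s t hs hts
    rcases Finset.mem_union.1 hs with h | h
    · exact Finset.mem_union.2 (Or.inl (Δ.down_closed h hts))
    · exact Finset.mem_union.2 (Or.inr (Γ.down_closed h hts))

/-- The intersection of two simplicial complexes (taken facewise). -/
def ainter (Δ Γ : ASC V) : ASC V where
  faces := Δ.faces ∩ Γ.faces
  down_closed := by
    intro s t hs hts
    rw [Finset.mem_inter] at hs ⊢
    exact ⟨Δ.down_closed hs.1 hts, Γ.down_closed hs.2 hts⟩

/-- The `k`-skeleton of `Δ`: all faces of dimension at most `k`. -/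
def skel (Δ : ASC V) (k : ℤ) : ASC V where
  faces := Δ.faces.filter fun s => (s.card : ℤ) ≤ k + 1
  down_closed := by
    intro s t hs hts
    simp only [mem_filter] at hs ⊢
    refine ⟨Δ.down_closed hs.1 hts, le_trans ?_ hs.2⟩
    exact_mod_cast Finset.card_le_card hts

section Boundary

variable {R : Type*} [CommRing R]

lemma bdry_add (a b : Finset V → R) : bdry (a + b) = bdry a + bdry b := by
  funext t
  simp [bdry, smul_add, sum_add_distrib]

lemma bdry_sub (a b : Finset V → R) : bdry (a - b) = bdry a - bdry b := by
  funext t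
  simp [bdry, smul_sub, sum_sub_distrib]

lemma bdry_zero : bdry (0 : Finset V → R) = 0 := by
  funext t
  simp [bdry]

lemma bdry_sum {ι : Type*} (s : Finset ι) (c : ι → Finset V → R) :
    bdry (∑ i ∈ s, c i) = ∑ i ∈ s, bdry (c i) := by
  induction s using Finset.induction_on with
  | empty => simpa using bdry_zero
  | insert i s hi ih => rw [sum_insert hi, sum_insert hi, bdry_add, ih]

lemma esign_mul_self (v : V) (t : Finset V) : esign v t * esign v t = 1 := by
  rw [esign, ← mul_pow]
  simp

lemma esign_insert (v w : V) (t : Finset V) (hv : v ∉ t) :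
    esign w (insert v t) = (if v < w then -1 else 1) * esign w t := by
  unfold esign
  rw [filter_insert]
  split_ifs
  · rw [card_insert_of_notMem (by simp [hv]), pow_succ']
  · rw [one_mul]

lemma esign_anticomm {v w : V} {t : Finset V} (hvw : v ≠ w) (hv : v ∉ t) (hw : w ∉ t) :
    esign v t * esign w (insert v t) = -(esign w t * esign v (insert w t)) := by
  rw [esign_insert v w t hv, esign_insert w v t hw]
  rcases lt_or_gt_of_ne hvw with h | h
  · rw [if_pos h, if_neg h.not_gt]
    ring
  · rw [if_neg h.not_gt, if_pos h]
    ring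

lemma bdry_bdry (c : Finset V → R) : bdry (bdry c) = 0 := by
  funext t
  simp only [bdry, smul_sum, Pi.zero_apply]
  rw [sum_sigma']
  refine sum_involution (fun p _ => ⟨p.2, p.1⟩) ?_ ?_ ?_ ?_
  · rintro ⟨v, w⟩ h
    simp only [mem_sigma, mem_compl, mem_insert, not_or] at h
    obtain ⟨hv, hwv, hw⟩ := h
    rw [smul_smul, smul_smul, esign_anticomm (Ne.symm hwv) hv hw, insert_comm v w t, neg_smul,
      neg_add_cancel]
  · rintro ⟨v, w⟩ h _ heq
    simp only [mem_sigma, mem_compl, mem_insert, not_or] at h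
    simp only [Sigma.mk.injEq] at heq
    exact h.2.1 heq.1
  · rintro ⟨v, w⟩ h
    simp only [mem_sigma, mem_compl, mem_insert, not_or] at h ⊢
    exact ⟨h.2.2, Ne.symm h.2.1, h.1⟩
  · rintro ⟨v, w⟩ _
    rfl

lemma exists_of_bdry_ne_zero {c : Finset V → R} {t : Finset V} (h : bdry c t ≠ 0) :
    ∃ v, v ∉ t ∧ c (insert v t) ≠ 0 := by
  obtain ⟨v, hv, hne⟩ := exists_ne_zero_of_sum_ne_zero h
  exact ⟨v, by simpa using hv, fun h0 => hne (by rw [h0, smul_zero])⟩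

/-- The cone over the chain `z` with apex `v`. -/
def cone (v : V) (z : Finset V → R) : Finset V → R :=
  fun s => if v ∈ s then esign v (s.erase v) • z (s.erase v) else 0

lemma bdry_cone (v : V) {z : Finset V → R} (hz : bdry z = 0) : bdry (cone v z) = z := by
  funext t
  by_cases hv : v ∈ t
  · obtain ⟨u, hu, rfl⟩ : ∃ u, v ∉ u ∧ insert v u = t :=
      ⟨t.erase v, notMem_erase v t, insert_erase hv⟩
    have hzu : bdry z u = 0 := by rw [hz]; rfl
    have hcompl : uᶜ = insert v (insert v u)ᶜ := by
      ext w
      by_cases h : w = v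
      · subst h; simp [hu]
      · simp [h]
    unfold bdry at hzu ⊢
    rw [hcompl, sum_insert (by simp)] at hzu
    have hterm : ∀ w ∈ (insert v u)ᶜ, esign w (insert v u) • cone v z (insert w (insert v u))
        = -(esign v u • (esign w u • z (insert w u))) := by
      intro w hw
      simp only [mem_compl, mem_insert, not_or] at hw
      have herase : (insert w (insert v u)).erase v = insert w u := by
        rw [insert_comm, erase_insert]
        simp [hu, Ne.symm hw.1]
      have hsign : esign w (insert v u) * esign v (insert w u) = -(esign v u * esign w u) := by
        have h := esign_anticomm (Ne.symm hw.1) hu hw.2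
        linear_combination (esign v u * esign v (insert w u)) * h
          - (esign w (insert v u) * esign v (insert w u)) * esign_mul_self v u
          - (esign v u * esign w u) * esign_mul_self v (insert w u)
      rw [cone, if_pos (by simp), herase, smul_smul, hsign, neg_smul, mul_smul]
    rw [sum_congr rfl hterm, sum_neg_distrib, ← smul_sum, eq_neg_of_add_eq_zero_right hzu,
      smul_neg, neg_neg, smul_smul, esign_mul_self, one_smul]
  · unfold bdry
    rw [sum_eq_single v]
    · rw [cone, if_pos (mem_insert_self v t), erase_insert hv, smul_smul, esign_mul_self, one_smul]
    · intro w _ hwv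
      rw [cone, if_neg (by simp [hv, Ne.symm hwv]), smul_zero]
    · intro h
      simp [hv] at h

end Boundary

section Chains

variable {R : Type*} [CommRing R] {S T : Set (Finset V)} {k : ℤ}

lemma IsChainOn.zero : IsChainOn S k (0 : Finset V → R) :=
  fun _ h => (h rfl).elim

lemma IsChainOn.add {a b : Finset V → R} (ha : IsChainOn S k a) (hb : IsChainOn S k b) :
    IsChainOn S k (a + b) := by
  intro s hs
  by_cases h : a s = 0
  · exact hb s fun h' => hs (by simp [h, h'])
  · exact ha s h

lemma IsChainOn.sub {a b : Finset V → R} (ha : IsChainOn S k a) (hb : IsChainOn S k b) :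
    IsChainOn S k (a - b) := by
  intro s hs
  by_cases h : a s = 0
  · exact hb s fun h' => hs (by simp [h, h'])
  · exact ha s h

lemma IsChainOn.mono (hST : ∀ s ∈ S, s ∈ T) {a : Finset V → R} (ha : IsChainOn S k a) :
    IsChainOn T k a :=
  fun s hs => ⟨hST s (ha s hs).1, (ha s hs).2⟩

lemma IsChainOn.sum {ι : Type*} (s : Finset ι) {c : ι → Finset V → R}
    (h : ∀ i ∈ s, IsChainOn S k (c i)) : IsChainOn S k (∑ i ∈ s, c i) := by
  induction s using Finset.induction_on with
  | empty => simpa using IsChainOn.zero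
  | insert i s hi ih =>
    rw [sum_insert hi]
    exact (h i (mem_insert_self i s)).add (ih fun j hj => h j (mem_insert_of_mem hj))

lemma IsChainOn.bdry (hS : IsLowerSet S) {a : Finset V → R} (ha : IsChainOn S k a) :
    IsChainOn S (k - 1) (bdry a) := by
  intro t ht
  obtain ⟨v, hv, hne⟩ := exists_of_bdry_ne_zero ht
  obtain ⟨hmem, hcard⟩ := ha _ hne
  rw [card_insert_of_notMem hv] at hcard
  exact ⟨hS (subset_insert v t) hmem, by push_cast at hcard; omega⟩

lemma hvanish_simplex (U : Finset V) (hk : 0 ≤ k) : HVanish R {s : Finset V | s ⊆ U} k := by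
  intro z hz hcycle
  by_cases h0 : z = 0
  · exact ⟨0, IsChainOn.zero, by rw [h0, bdry_zero]⟩
  obtain ⟨s, hs⟩ := Function.ne_iff.1 h0
  obtain ⟨hsU, hcard⟩ := hz s hs
  obtain ⟨v, hv⟩ : s.Nonempty := card_pos.1 (by omega)
  refine ⟨cone v z, ?_, bdry_cone v hcycle⟩
  intro t ht
  have hvt : v ∈ t := by
    by_contra h
    exact ht (if_neg h)
  have hne : z (t.erase v) ≠ 0 := by
    intro h
    exact ht (by rw [cone, if_pos hvt, h, smul_zero])
  obtain ⟨hsub, hc⟩ := hz _ hne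
  refine ⟨?_, ?_⟩
  · rw [← insert_erase hvt]
    exact insert_subset (hsU hv) hsub
  · rw [← card_erase_add_one hvt]
    push_cast
    omega

/-- Mayer–Vietoris induction: the faces of `S` not containing `σ` are covered by the faces
avoiding a vertex of `σ`, and the homology of the union is controlled by that of the
intersections. -/
lemma hvanish_not_superset (σ : Finset V) :
    ∀ {S : Set (Finset V)} {ℓ : ℤ}, IsLowerSet S →
      (∀ τ ⊆ σ, τ.Nonempty → HVanish R {s ∈ S | Disjoint s τ} (ℓ + 1 - τ.card)) →
      HVanish R {s ∈ S | ¬ σ ⊆ s} ℓ := by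
  induction σ using Finset.induction_on with
  | empty =>
    intro S ℓ _ _ z hz _
    refine ⟨0, IsChainOn.zero, ?_⟩
    rw [bdry_zero]
    funext s
    by_contra h
    exact (hz s (Ne.symm h)).1.2 (empty_subset s)
  | insert v σ hv ih =>
    intro S ℓ hS hvan z hz hcycle
    have hlower : ∀ τ : Finset V, IsLowerSet {s ∈ S | Disjoint s τ} :=
      fun τ s t hts hs => ⟨hS hts hs.1, hs.2.mono_left hts⟩
    have hlower' : IsLowerSet {s ∈ S | ¬ σ ⊆ s} :=
      fun s t hts hs => ⟨hS hts hs.1, fun h => hs.2 (h.trans hts)⟩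
    set a : Finset V → R := fun s => if v ∈ s then 0 else z s with ha_def
    set b : Finset V → R := fun s => if v ∈ s then z s else 0 with hb_def
    have hab : a + b = z := by
      funext s
      simp only [ha_def, hb_def, Pi.add_apply]
      split_ifs <;> simp
    have ha : IsChainOn {s ∈ S | Disjoint s {v}} ℓ a := by
      intro s hs
      have hvs : v ∉ s := fun h => hs (if_pos h)
      have hzs : z s ≠ 0 := fun h => hs (by simp [ha_def, h])
      exact ⟨⟨(hz s hzs).1.1, by simpa using hvs⟩, (hz s hzs).2⟩
    have hb : IsChainOn {s ∈ S | ¬ σ ⊆ s} ℓ b := by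
      intro s hs
      have hvs : v ∈ s := by
        by_contra h
        exact hs (if_neg h)
      have hzs : z s ≠ 0 := fun h => hs (by simp [hb_def, h])
      exact ⟨⟨(hz s hzs).1.1, fun h => (hz s hzs).1.2 (insert_subset hvs h)⟩, (hz s hzs).2⟩
    have hbdry : bdry a + bdry b = 0 := by rw [← bdry_add, hab, hcycle]
    have hda : IsChainOn {s ∈ {s ∈ S | Disjoint s {v}} | ¬ σ ⊆ s} (ℓ - 1) (bdry a) := by
      intro s hs
      have hs' : bdry b s ≠ 0 := by
        intro h
        have := congrFun hbdry s
        rw [Pi.add_apply, h, add_zero] at this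
        exact hs this
      have h1 := ha.bdry (hlower _) s hs
      exact ⟨⟨h1.1, (hb.bdry hlower' s hs').1.2⟩, h1.2⟩
    obtain ⟨c, hc, hca⟩ := ih (S := {s ∈ S | Disjoint s {v}}) (ℓ := ℓ - 1) (hlower _)
      (by
        intro τ hτ _
        have h := hvan (insert v τ) (insert_subset_insert v hτ) (insert_nonempty v τ)
        rw [card_insert_of_notMem fun h' => hv (hτ h')] at h
        convert h using 1
        · ext s
          simp only [Set.mem_ofPred_eq, disjoint_insert_right, disjoint_singleton_right, and_assoc]
        · push_cast
          ring)
      _ hda (bdry_bdry a)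
    rw [sub_add_cancel] at hc
    obtain ⟨e, he, hea⟩ := hvan {v} (by simp) (by simp) (a - c)
      (by
        rw [card_singleton, Nat.cast_one, add_sub_cancel_right]
        exact ha.sub (hc.mono fun s hs => hs.1))
      (by rw [bdry_sub, hca, sub_self])
    rw [card_singleton, Nat.cast_one, add_sub_cancel_right] at he
    obtain ⟨f, hf, hfb⟩ := ih (S := S) (ℓ := ℓ) hS
      (fun τ hτ hne => hvan τ (hτ.trans (subset_insert v σ)) hne) (b + c)
      (hb.add (hc.mono fun s hs => by exact ⟨hs.1.1, hs.2⟩))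
      (by rw [bdry_add, hca, add_comm, hbdry])
    refine ⟨e + f, ?_, ?_⟩
    · exact IsChainOn.add
        (he.mono fun s hs => by
          exact ⟨hs.1, fun h => disjoint_singleton_right.1 hs.2 (h (mem_insert_self v σ))⟩)
        (hf.mono fun s hs => by exact ⟨hs.1, fun h => hs.2 ((subset_insert v σ).trans h)⟩)
    · rw [bdry_add, hea, hfb, ← hab]
      abel

end Chains

section Chordality

variable {R : Type*} [CommRing R] {Δ : ASC V} {ℓ : ℤ}

lemma exists_missingFace_subset {U : Finset V} (hU : U ∉ Δ.faces) :
    ∃ σ ⊆ U, IsMissingFace Δ σ := by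
  induction U using Finset.strongInduction with
  | H U ih =>
    by_cases h : ∀ t ⊂ U, t ∈ Δ.faces
    · exact ⟨U, Subset.rfl, hU, h⟩
    · push Not at h
      obtain ⟨t, htU, ht⟩ := h
      obtain ⟨σ, hσ, hmis⟩ := ih t htU ht
      exact ⟨σ, hσ.trans htU.subset, hmis⟩

lemma mem_faces_of_card_eq {k : ℤ}
    (hmissing : ∀ σ : Finset V, IsMissingFace Δ σ → (σ.card : ℤ) ≤ k + 1) (hk : k ≤ ℓ)
    {U : Finset V} (hcard : (U.card : ℤ) = ℓ + 2)
    (hU : ∀ s ⊆ U, (s.card : ℤ) = ℓ + 1 → s ∈ Δ.faces) : U ∈ Δ.faces := by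
  by_contra hmem
  obtain ⟨σ, hσU, hσ⟩ := exists_missingFace_subset hmem
  have hle := hmissing σ hσ
  obtain ⟨s, hσs, hsU, hs⟩ := exists_subsuperset_card_eq (n := U.card - 1) hσU (by omega) (by omega)
  exact hσ.1 (Δ.down_closed (hU s hsU (by omega)) hσs)

lemma coe_induced_faces (W : Finset V) :
    ((induced Δ W).faces : Set (Finset V)) = {s | s ∈ Δ.faces ∧ s ⊆ W} := by
  ext s
  simp [induced]

lemma DecChordal.hvanish_induced {k : ℤ} (h : DecChordal R Δ ℓ)
    (hmissing : ∀ σ : Finset V, IsMissingFace Δ σ → (σ.card : ℤ) ≤ k + 1)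
    (hk : k ≤ ℓ) (hℓ : 0 ≤ ℓ) (W : Finset V) :
    HVanish R ((induced Δ W).faces : Set (Finset V)) ℓ := by
  rw [coe_induced_faces]
  intro z hz hcycle
  obtain ⟨n, zs, hsum, hzs⟩ := h z (hz.mono fun s hs => hs.1) hcycle
  have hbound : ∀ i, ∃ c : Finset V → R,
      IsChainOn {s | s ∈ Δ.faces ∧ s ⊆ W} (ℓ + 1) c ∧ bdry c = zs i := by
    intro i
    obtain ⟨⟨hcyc, U, hUcard, hUsupp, hUfaces⟩, hsub⟩ := hzs i
    have hUmem : U ∈ Δ.faces := mem_faces_of_card_eq hmissing hk hUcard hUfaces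
    have hUW : U ⊆ W := by
      intro v hv
      obtain ⟨s, hvs, hsU, hs⟩ := exists_subsuperset_card_eq (n := U.card - 1)
        (singleton_subset_iff.2 hv) (by rw [card_singleton]; omega) (by omega)
      obtain ⟨t, ht, hvt⟩ := hsub ⟨s, (hUsupp s).2 ⟨hsU, by omega⟩, singleton_subset_iff.1 hvs⟩
      exact (hz t ht).1.2 hvt
    obtain ⟨c, hc, hcb⟩ := hvanish_simplex (R := R) U hℓ (zs i)
      (fun s hs => (hUsupp s).1 hs) hcyc
    exact ⟨c, hc.mono fun s hs => by exact ⟨Δ.down_closed hUmem hs, hs.trans hUW⟩, hcb⟩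
  choose c hc hcb using hbound
  refine ⟨∑ i, c i, IsChainOn.sum _ fun i _ => hc i, ?_⟩
  rw [bdry_sum, hsum]
  exact sum_congr rfl fun i _ => hcb i

lemma bdry_single_ne_zero_iff {s t : Finset V} {r : R} (hr : r ≠ 0) :
    bdry (Pi.single s r) t ≠ 0 ↔ t ⊆ s ∧ s.card = t.card + 1 := by
  constructor
  · intro h
    obtain ⟨v, hv, hne⟩ := exists_of_bdry_ne_zero h
    have hs : insert v t = s := by
      by_contra hcon
      exact hne (by rw [Pi.single_apply, if_neg hcon])
    rw [← hs, card_insert_of_notMem hv]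
    exact ⟨subset_insert v t, rfl⟩
  · rintro ⟨hts, hcard⟩
    obtain ⟨v, hv, rfl⟩ : ∃ v, v ∉ t ∧ insert v t = s := by
      obtain ⟨v, hv⟩ := card_eq_one.1
        (show (s \ t).card = 1 by rw [card_sdiff_of_subset hts]; omega)
      refine ⟨v, fun h => ?_, ?_⟩
      · exact (mem_sdiff.1 (hv ▸ mem_singleton_self v)).2 h
      · rw [insert_eq, ← hv, sdiff_union_of_subset hts]
    unfold bdry
    rw [sum_eq_single v]
    · intro h
      rw [Pi.single_eq_same] at h
      apply hr
      rw [← one_smul ℤ r, ← esign_mul_self v t, mul_smul, h, smul_zero]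
    · intro w hw hwv
      rw [Pi.single_eq_of_ne, smul_zero]
      intro heq
      have hmem : w ∈ insert v t := heq ▸ mem_insert_self w t
      rcases mem_insert.1 hmem with h | h
      · exact hwv h
      · exact mem_compl.1 hw h
    · intro h
      exact (h (mem_compl.2 hv)).elim

lemma decChordal_of_hvanish_induced
    (h : ∀ W : Finset V, HVanish R ((induced Δ W).faces : Set (Finset V)) ℓ) :
    DecChordal R Δ ℓ := by
  intro z hz hcycle
  set W : Finset V := univ.filter fun v => v ∈ vsupp z
  obtain ⟨c, hc, rfl⟩ := h W z
    (by
      rw [coe_induced_faces]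
      exact fun s hs => ⟨⟨(hz s hs).1, fun v hv => mem_filter.2 ⟨mem_univ v, s, hs, hv⟩⟩,
        (hz s hs).2⟩)
    hcycle
  rw [coe_induced_faces] at hc
  set F : Finset (Finset V) := univ.filter fun s => c s ≠ 0
  refine ⟨F.card, fun i => bdry (Pi.single (F.equivFin.symm i : Finset V)
    (c (F.equivFin.symm i))), ?_, ?_⟩
  · rw [← bdry_sum,
      F.equivFin.symm.sum_comp fun s : F => (Pi.single (s : Finset V) (c s) : Finset V → R),
      sum_coe_sort F fun s => (Pi.single s (c s) : Finset V → R)]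
    congr 1
    funext t
    rw [Finset.sum_apply]
    by_cases ht : c t = 0
    · rw [ht, sum_eq_zero]
      intro s hs
      refine Pi.single_eq_of_ne ?_ _
      rintro rfl
      exact (mem_filter.1 hs).2 ht
    · rw [sum_eq_single t (fun s _ hst => Pi.single_eq_of_ne (Ne.symm hst) _)
        (fun hn => (hn (mem_filter.2 ⟨mem_univ t, ht⟩)).elim), Pi.single_eq_same]
  · intro i
    beta_reduce
    have hcs := (mem_filter.1 (F.equivFin.symm i).2).2
    generalize (F.equivFin.symm i : Finset V) = s at hcs ⊢
    obtain ⟨⟨hsΔ, hsW⟩, hcard⟩ := hc s hcs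
    refine ⟨⟨bdry_bdry _, s, by omega, fun t => ?_, fun t ht _ => Δ.down_closed hsΔ ht⟩, ?_⟩
    · rw [bdry_single_ne_zero_iff hcs]
      exact and_congr_right fun _ => ⟨fun h => by omega, fun h => by omega⟩
    · rintro v ⟨t, ht, hvt⟩
      exact (mem_filter.1 (hsW (((bdry_single_ne_zero_iff hcs).1 ht).1 hvt))).2

lemma hvanish_induced_of_range {k : ℤ} (hk : 1 ≤ k)
    (hmissing : ∀ σ : Finset V, IsMissingFace Δ σ → (σ.card : ℤ) ≤ k + 1)
    (hrange : ∀ ℓ : ℤ, k ≤ ℓ → ℓ ≤ 2 * k - 1 → ∀ W : Finset V,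
      HVanish R ((induced Δ W).faces : Set (Finset V)) ℓ) (W : Finset V) :
    ∀ ℓ : ℤ, k ≤ ℓ → HVanish R ((induced Δ W).faces : Set (Finset V)) ℓ := by
  induction W using Finset.strongInduction with
  | H W ih =>
    intro ℓ hℓ
    by_cases hle : ℓ ≤ 2 * k - 1
    · exact hrange ℓ hℓ hle W
    by_cases hW : W ∈ Δ.faces
    · convert hvanish_simplex (R := R) W (show 0 ≤ ℓ by omega) using 1
      rw [coe_induced_faces]
      ext s
      exact ⟨fun hs => hs.2, fun hs => ⟨Δ.down_closed hW hs, hs⟩⟩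
    obtain ⟨σ, hσW, hσ⟩ := exists_missingFace_subset hW
    have hσcard := hmissing σ hσ
    convert hvanish_not_superset (R := R) σ (S := ((induced Δ W).faces : Set (Finset V)))
      (ℓ := ℓ) (fun s t hts hs => (induced Δ W).down_closed hs hts) ?_ using 1
    · ext s
      refine ⟨fun hs => ⟨hs, fun h => ?_⟩, fun hs => hs.1⟩
      rw [coe_induced_faces] at hs
      exact hσ.1 (Δ.down_closed hs.1 h)
    · intro τ hτ hne
      have hτcard := card_le_card hτ
      convert ih (W \ τ) (sdiff_ssubset (hτ.trans hσW) hne) (ℓ + 1 - τ.card) (by omega) using 1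
      rw [coe_induced_faces, coe_induced_faces]
      ext s
      simp only [Set.mem_ofPred_eq, subset_sdiff, and_assoc]

end Chordality

/-- **Propagation of chordality** (Theorem 1.2 of Adiprasito–Nevo–Samper).
If `Δ` is decomposition `ℓ`-chordal over `R` for all `k ≤ ℓ ≤ 2k - 1` and has
no missing faces of dimension `> k`, then `Δ` is decomposition `ℓ`-chordal for
all `ℓ ≥ k` and is `k`-Leray over `R`. -/
theorem propagation_of_chordality {V : Type*} [Fintype V] [LinearOrder V]
    (R : Type*) [CommRing R] (k : ℤ) (hk : 1 ≤ k) (Δ : ASC V)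
    (hchordal : ∀ ℓ : ℤ, k ≤ ℓ → ℓ ≤ 2 * k - 1 → DecChordal R Δ ℓ)
    (hmissing : ∀ σ : Finset V, IsMissingFace Δ σ → (σ.card : ℤ) ≤ k + 1) :
    (∀ ℓ : ℤ, k ≤ ℓ → DecChordal R Δ ℓ) ∧ IsLeray R Δ k := by
  have hLeray : ∀ (W : Finset V) (j : ℤ), k ≤ j →
      HVanish R ((induced Δ W).faces : Set (Finset V)) j :=
    hvanish_induced_of_range hk hmissing fun ℓ h1 h2 =>
      (hchordal ℓ h1 h2).hvanish_induced hmissing h1 (by omega)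
  exact ⟨fun ℓ hℓ => decChordal_of_hvanish_induced fun W => hLeray W ℓ hℓ, hLeray⟩
end
end

section
/- Let R be a commutative ring, k ≥ 0, and let Δ be a finite abstract simplicial complex. Then Δ is resolution k-chordal over R if and only if the reduced homology H̃_k(Δ|V; R) vanishes for every subset V of the vertices of Δ. -/
/-!
Basic notions for homological chordality of simplicial complexes,
following Adiprasito–Nevo–Samper, "Higher chordality: From graphs to complexes".

A finite abstract simplicial complex is modelled as a downward-closed finite
family of finite subsets of a vertex type `V`.  Chains of dimension `k` (with
coefficients in a commutative ring `R`) are functions `Finset V → R` supported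
on faces of cardinality `k + 1`; the simplicial boundary operator includes the
augmentation (so `0`-cycles are *reduced* cycles), matching the paper's
convention that `C₋₁` is generated by the empty face.
-/

open Finset

attribute [local instance] Classical.propDecidable

noncomputable section

variable {V : Type*} [Fintype V] [LinearOrder V]

theorem vsupp_bdry_subset {R : Type*} [CommRing R] (c : Finset V → R) :
    vsupp (bdry c) ⊆ vsupp c := by
  rintro v ⟨s, hs, hv⟩
  obtain ⟨w, -, hw⟩ := Finset.exists_ne_zero_of_sum_ne_zero hs
  exact ⟨insert w s, fun h => hw (by rw [h, smul_zero]), mem_insert_of_mem hv⟩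

omit [Fintype V] [LinearOrder V] in
theorem isChainOn_induced_iff {R : Type*} [CommRing R] (Δ : ASC V) (W : Finset V) (k : ℤ)
    (c : Finset V → R) :
    IsChainOn (↑(induced Δ W).faces) k c ↔ IsChainOn (↑Δ.faces) k c ∧ vsupp c ⊆ ↑W := by
  simp only [IsChainOn, induced, coe_filter, Set.mem_ofPred_eq, mem_coe]
  constructor
  · refine fun h => ⟨fun s hs => ⟨(h s hs).1.1, (h s hs).2⟩, ?_⟩
    rintro v ⟨s, hs, hv⟩
    exact (h s hs).1.2 hv
  · exact fun h s hs => ⟨⟨(h.1 s hs).1, fun v hv => h.2 ⟨s, hs, hv⟩⟩, (h.1 s hs).2⟩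

/-- Fact 3.1(4): `Δ` is resolution `k`-chordal over `R` if and only if the
reduced homology `H̃ₖ(Δ|W; R)` vanishes for every vertex subset `W`. -/
theorem resChordal_iff_induced_homology_vanish {V : Type*} [Fintype V] [LinearOrder V]
    (R : Type*) [CommRing R] (k : ℤ) (hk : 0 ≤ k) (Δ : ASC V) :
    ResChordal R Δ k ↔
      ∀ W : Finset V, HVanish R (((induced Δ W).faces : Set (Finset V))) k := by
  constructor
  · intro h W z hz hzc
    rw [isChainOn_induced_iff] at hz
    obtain ⟨c, hc, hb, hv⟩ := h z hz.1 hzc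
    exact ⟨c, (isChainOn_induced_iff _ _ _ _).2 ⟨hc, hv ▸ hz.2⟩, hb⟩
  · intro h z hz hzc
    obtain ⟨c, hc, rfl⟩ := h (vsupp z).toFinset z
      ((isChainOn_induced_iff _ _ _ _).2 ⟨hz, by simp⟩) hzc
    rw [isChainOn_induced_iff, Set.coe_toFinset] at hc
    exact ⟨c, hc.1, rfl, hc.2.antisymm (vsupp_bdry_subset c)⟩
end
end
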